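/- arXiv:2412.02657 — 2 statements merged into one kernel-verified Lean document; each statement's English description precedes it below -/
import Mathlib

section
/- Let δ ∈ {1, −1}, and let f_{ij}, F, G : ℝ¹⁰ → ℝ be smooth functions satisfying the jet-level pss/ss conditions: (i) each f_{i1} depends only on (x, t, z₀, y₀), each f_{i2} depends only on (x, t, z₀, z₁, z₂, y₀, y₁, y₂); (ii) (f₁₁,_{z₀}f₂₁,_{y₀} − f₁₁,_{y₀}f₂₁,_{z₀})² + (f₂₁,_{z₀}f₃₁,_{y₀} − f₂₁,_{y₀}f₃₁,_{z₀})² + (f₁₁,_{z₀}f₃₁,_{y₀} − f₁₁,_{y₀}f₃₁,_{z₀})² ≠ 0 at every point; (iii) −f_{i1,z₀}F − f_{i1,y₀}G − f_{i1,t} + D_x f_{i2} − E_i = 0 identically, where E₁ = f₃₁f₂₂ − f₃₂f₂₁, E₂ = f₁₁f₃₂ − f₁₂f₃₁, E₃ = δ(f₁₁f₂₂ − f₁₂f₂₁). Then F and G are affine in z₃ and y₃: there exist smooth functions F₁, F₂, F₃, G₁, G₂, G₃ of (x, t, z₀, z₁, z₂, y₀, y₁, y₂) such that F = F₁z₃ +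 F₂y₃ + F₃ and G = G₁z₃ + G₂y₃ + G₃ identically on ℝ¹⁰. -/
/-- Jet coordinates on ℝ¹⁰: `(x, t, z₀, z₁, z₂, z₃, y₀, y₁, y₂, y₃)`,
indexed by `0, …, 9`.  `pd i f` is the partial derivative of `f` with respect
to the `i`-th coordinate. -/
noncomputable def pd (i : Fin 10) (f : (Fin 10 → ℝ) → ℝ) : (Fin 10 → ℝ) → ℝ :=
  fun p => fderiv ℝ f p (Pi.single i 1)

/-- Total derivative with respect to `x`:
`Dx Q = Q_x + Σ_{i=0}^{2} (Q_{z_i} z_{i+1} + Q_{y_i} y_{i+1})`. -/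
noncomputable def Dx (f : (Fin 10 → ℝ) → ℝ) : (Fin 10 → ℝ) → ℝ := fun p =>
  pd 0 f p + pd 2 f p * p 3 + pd 3 f p * p 4 + pd 4 f p * p 5
    + pd 6 f p * p 7 + pd 7 f p * p 8 + pd 8 f p * p 9

/-- `f` depends only on `(x, t, z₀, y₀)`. -/
def DepXTZ0Y0 (f : (Fin 10 → ℝ) → ℝ) : Prop :=
  ∀ p, pd 3 f p = 0 ∧ pd 4 f p = 0 ∧ pd 5 f p = 0 ∧
    pd 7 f p = 0 ∧ pd 8 f p = 0 ∧ pd 9 f p = 0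

/-- `f` depends only on `(x, t, z₀, z₁, z₂, y₀, y₁, y₂)`. -/
def DepSecOrder (f : (Fin 10 → ℝ) → ℝ) : Prop :=
  ∀ p, pd 5 f p = 0 ∧ pd 9 f p = 0

/-- The vector `s e₅ + r e₉`. -/
noncomputable def hv (s r : ℝ) : Fin 10 → ℝ := s • Pi.single 5 1 + r • Pi.single 9 1

theorem const_of_pd (i : Fin 10) (f : (Fin 10 → ℝ) → ℝ) (hf : Differentiable ℝ f)
    (h : ∀ p, pd i f p = 0) (p : Fin 10 → ℝ) (s : ℝ) :
    f (p + s • Pi.single i 1) = f p := by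
  have hd : ∀ u : ℝ, HasDerivAt (fun u : ℝ => f (p + u • Pi.single i (1:ℝ))) 0 u := by
    intro u
    have h1 : HasDerivAt (fun u : ℝ => p + u • (Pi.single i (1:ℝ) : Fin 10 → ℝ))
        (Pi.single i (1:ℝ)) u := by
      simpa using ((hasDerivAt_id u).smul_const (Pi.single i (1:ℝ) : Fin 10 → ℝ)).const_add p
    have h2 := (hf (p + u • Pi.single i (1:ℝ))).hasFDerivAt.comp_hasDerivAt u h1
    have h3 := h (p + u • Pi.single i (1:ℝ))
    unfold pd at h3
    rw [h3] at h2
    exact h2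
  have := is_const_of_deriv_eq_zero (fun u => (hd u).differentiableAt) (fun u => (hd u).deriv) s 0
  simpa using this

theorem inv_of_dep (f : (Fin 10 → ℝ) → ℝ) (hf : Differentiable ℝ f)
    (h5 : ∀ p, pd 5 f p = 0) (h9 : ∀ p, pd 9 f p = 0) (p : Fin 10 → ℝ) (s r : ℝ) :
    f (p + hv s r) = f p := by
  unfold hv
  rw [← add_assoc, const_of_pd 9 f hf h9, const_of_pd 5 f hf h5]

theorem pd_inv (f : (Fin 10 → ℝ) → ℝ) (h : ∀ p s r, f (p + hv s r) = f p)
    (i : Fin 10) (p : Fin 10 → ℝ) (s r : ℝ) : pd i f (p + hv s r) = pd i f p := by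
  unfold pd
  rw [← fderiv_comp_add_right (f := f) (hv s r)]
  simp only [h]

theorem pd_zero_of_inv (i : Fin 10) (f : (Fin 10 → ℝ) → ℝ) (hf : Differentiable ℝ f)
    (h : ∀ p (s : ℝ), f (p + s • Pi.single i 1) = f p) (p : Fin 10 → ℝ) : pd i f p = 0 := by
  unfold pd
  rw [← (hf p).lineDeriv_eq_fderiv]
  simp [lineDeriv, h]

/-- The projection killing coordinates 5 and 9. -/
noncomputable def pr (p : Fin 10 → ℝ) : Fin 10 → ℝ := p + hv (-p 5) (-p 9)

theorem pr_contDiff : ContDiff ℝ (⊤ : ℕ∞) pr := by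
  unfold pr hv
  fun_prop

theorem pr5 (p : Fin 10 → ℝ) (s : ℝ) : pr (p + s • Pi.single 5 1) = pr p := by
  simp only [pr, hv]
  ext j
  fin_cases j <;> simp [Pi.single_apply]

theorem pr9 (p : Fin 10 → ℝ) (s : ℝ) : pr (p + s • Pi.single 9 1) = pr p := by
  simp only [pr, hv]
  ext j
  fin_cases j <;> simp [Pi.single_apply]

theorem dep_of_pr (g : (Fin 10 → ℝ) → ℝ) (hg : ContDiff ℝ (⊤ : ℕ∞) g)
    (h : ∀ p q, pr p = pr q → g p = g q) : DepSecOrder g := by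
  have hd : Differentiable ℝ g := hg.differentiable (by simp)
  exact fun p => ⟨pd_zero_of_inv 5 g hd (fun p s => h _ _ (pr5 p s)) p,
    pd_zero_of_inv 9 g hd (fun p s => h _ _ (pr9 p s)) p⟩

theorem eq_pr (p : Fin 10 → ℝ) : p = pr p + hv (p 5) (p 9) := by
  simp only [pr, hv]
  ext j
  simp only [Pi.add_apply, Pi.smul_apply, smul_eq_mul]
  ring

theorem Dx_inv (f : (Fin 10 → ℝ) → ℝ) (h : ∀ p s r, f (p + hv s r) = f p)
    (p : Fin 10 → ℝ) (s r : ℝ) :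
    Dx f (p + hv s r) = Dx f p + pd 4 f p * s + pd 8 f p * r := by
  unfold Dx
  simp only [pd_inv f h]
  simp [hv, Pi.single_apply]
  ring

/-- One linear relation at the four points gives a homogeneous relation for the defects. -/
theorem relation (F G a b E : (Fin 10 → ℝ) → ℝ) (c : (Fin 10 → ℝ) → ℝ)
    (hc : ∀ p s r, c (p + hv s r) = c p)
    (ha : ∀ p s r, a (p + hv s r) = a p) (hb : ∀ p s r, b (p + hv s r) = b p)
    (hE : ∀ p s r, E (p + hv s r) = E p)
    (f : (Fin 10 → ℝ) → ℝ) (hf : ∀ p s r, f (p + hv s r) = f p)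
    (hid : ∀ p, -(a p) * F p - b p * G p - c p + Dx f p - E p = 0)
    (q : Fin 10 → ℝ) (s r : ℝ) :
    a q * (F (q + hv s r) - (F (q + hv 1 0) - F q) * s - (F (q + hv 0 1) - F q) * r - F q)
    + b q * (G (q + hv s r) - (G (q + hv 1 0) - G q) * s - (G (q + hv 0 1) - G q) * r - G q)
      = 0 := by
  have e0 := hid q
  have e1 := hid (q + hv 1 0)
  have e2 := hid (q + hv 0 1)
  have e3 := hid (q + hv s r)
  simp only [ha, hb, hc, hE, Dx_inv f hf] at e1 e2 e3
  linear_combination -e3 + s * (e1 - e0) + r * (e2 - e0) + e0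

theorem solve (a b c d e f X Y : ℝ)
    (h : (a * d - b * c) ^ 2 + (c * f - d * e) ^ 2 + (a * f - b * e) ^ 2 ≠ 0)
    (h1 : a * X + b * Y = 0) (h2 : c * X + d * Y = 0) (h3 : e * X + f * Y = 0) :
    X = 0 ∧ Y = 0 := by
  constructor
  · refine (mul_eq_zero.1 (?_ : _ * X = 0)).resolve_left h
    linear_combination (a*d-b*c) * (d*h1 - b*h2) + (c*f-d*e)*(f*h2-d*h3) + (a*f-b*e)*(f*h1-b*h3)
  · refine (mul_eq_zero.1 (?_ : _ * Y = 0)).resolve_left h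
    linear_combination (a*d-b*c) * (a*h2 - c*h1) + (c*f-d*e)*(c*h3-e*h2) + (a*f-b*e)*(a*h3-e*h1)

/-- If the system `z₀ₜ = F`, `y₀ₜ = G` admits associated functions satisfying
the jet-level pss/ss conditions (i)–(iii), then `F` and `G` are affine in the
highest-order derivatives `z₃` and `y₃`. -/
theorem F_G_affine_in_third_derivatives (δ : ℝ) (hδ : δ = 1 ∨ δ = -1)
    (F G f11 f12 f21 f22 f31 f32 : (Fin 10 → ℝ) → ℝ)
    (hF : ContDiff ℝ (⊤ : ℕ∞) F) (hG : ContDiff ℝ (⊤ : ℕ∞) G)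
    (h11 : ContDiff ℝ (⊤ : ℕ∞) f11) (h12 : ContDiff ℝ (⊤ : ℕ∞) f12)
    (h21 : ContDiff ℝ (⊤ : ℕ∞) f21) (h22 : ContDiff ℝ (⊤ : ℕ∞) f22)
    (h31 : ContDiff ℝ (⊤ : ℕ∞) f31) (h32 : ContDiff ℝ (⊤ : ℕ∞) f32)
    (hd11 : DepXTZ0Y0 f11) (hd21 : DepXTZ0Y0 f21) (hd31 : DepXTZ0Y0 f31)
    (hd12 : DepSecOrder f12) (hd22 : DepSecOrder f22) (hd32 : DepSecOrder f32)
    (hgen : ∀ p,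
      (pd 2 f11 p * pd 6 f21 p - pd 6 f11 p * pd 2 f21 p) ^ 2
        + (pd 2 f21 p * pd 6 f31 p - pd 6 f21 p * pd 2 f31 p) ^ 2
        + (pd 2 f11 p * pd 6 f31 p - pd 6 f11 p * pd 2 f31 p) ^ 2 ≠ 0)
    (hid1 : ∀ p, -(pd 2 f11 p) * F p - pd 6 f11 p * G p - pd 1 f11 p + Dx f12 p
      - (f31 p * f22 p - f32 p * f21 p) = 0)
    (hid2 : ∀ p, -(pd 2 f21 p) * F p - pd 6 f21 p * G p - pd 1 f21 p + Dx f22 p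
      - (f11 p * f32 p - f12 p * f31 p) = 0)
    (hid3 : ∀ p, -(pd 2 f31 p) * F p - pd 6 f31 p * G p - pd 1 f31 p + Dx f32 p
      - δ * (f11 p * f22 p - f12 p * f21 p) = 0) :
    ∃ F1 F2 F3 G1 G2 G3 : (Fin 10 → ℝ) → ℝ,
      ContDiff ℝ (⊤ : ℕ∞) F1 ∧ ContDiff ℝ (⊤ : ℕ∞) F2 ∧ ContDiff ℝ (⊤ : ℕ∞) F3 ∧
      ContDiff ℝ (⊤ : ℕ∞) G1 ∧ ContDiff ℝ (⊤ : ℕ∞) G2 ∧ ContDiff ℝ (⊤ : ℕ∞) G3 ∧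
      DepSecOrder F1 ∧ DepSecOrder F2 ∧ DepSecOrder F3 ∧
      DepSecOrder G1 ∧ DepSecOrder G2 ∧ DepSecOrder G3 ∧
      (∀ p, F p = F1 p * p 5 + F2 p * p 9 + F3 p) ∧
      (∀ p, G p = G1 p * p 5 + G2 p * p 9 + G3 p) := by
  have df : ∀ {f : (Fin 10 → ℝ) → ℝ}, ContDiff ℝ (⊤ : ℕ∞) f → Differentiable ℝ f :=
    fun h => h.differentiable (by simp)
  have i11 := inv_of_dep f11 (df h11) (fun p => (hd11 p).2.2.1) (fun p => (hd11 p).2.2.2.2.2)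
  have i21 := inv_of_dep f21 (df h21) (fun p => (hd21 p).2.2.1) (fun p => (hd21 p).2.2.2.2.2)
  have i31 := inv_of_dep f31 (df h31) (fun p => (hd31 p).2.2.1) (fun p => (hd31 p).2.2.2.2.2)
  have i12 := inv_of_dep f12 (df h12) (fun p => (hd12 p).1) (fun p => (hd12 p).2)
  have i22 := inv_of_dep f22 (df h22) (fun p => (hd22 p).1) (fun p => (hd22 p).2)
  have i32 := inv_of_dep f32 (df h32) (fun p => (hd32 p).1) (fun p => (hd32 p).2)
  have key : ∀ q s r,
      (F (q + hv s r) - (F (q + hv 1 0) - F q) * s - (F (q + hv 0 1) - F q) * r - F q) = 0 ∧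
      (G (q + hv s r) - (G (q + hv 1 0) - G q) * s - (G (q + hv 0 1) - G q) * r - G q) = 0 := by
    intro q s r
    refine solve _ _ _ _ _ _ _ _ (hgen q) ?_ ?_ ?_
    · exact relation F G _ _ (fun p => f31 p * f22 p - f32 p * f21 p) _ (pd_inv f11 i11 1)
        (pd_inv f11 i11 2) (pd_inv f11 i11 6)
        (fun p s r => by simp only [i31, i22, i32, i21]) f12 i12 hid1 q s r
    · exact relation F G _ _ (fun p => f11 p * f32 p - f12 p * f31 p) _ (pd_inv f21 i21 1)
        (pd_inv f21 i21 2) (pd_inv f21 i21 6)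
        (fun p s r => by simp only [i11, i32, i12, i31]) f22 i22 hid2 q s r
    · exact relation F G _ _ (fun p => δ * (f11 p * f22 p - f12 p * f21 p)) _ (pd_inv f31 i31 1)
        (pd_inv f31 i31 2) (pd_inv f31 i31 6)
        (fun p s r => by simp only [i11, i22, i12, i21]) f32 i32 hid3 q s r
  have c3 : ∀ {H : (Fin 10 → ℝ) → ℝ}, ContDiff ℝ (⊤ : ℕ∞) H →
      ContDiff ℝ (⊤ : ℕ∞) (fun p => H (pr p)) := fun h => h.comp pr_contDiff
  have c1 : ∀ {H : (Fin 10 → ℝ) → ℝ} (v : Fin 10 → ℝ), ContDiff ℝ (⊤ : ℕ∞) H →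
      ContDiff ℝ (⊤ : ℕ∞) (fun p => H (pr p + v) - H (pr p)) :=
    fun v h => (h.comp (pr_contDiff.add contDiff_const)).sub (c3 h)
  refine ⟨fun p => F (pr p + hv 1 0) - F (pr p), fun p => F (pr p + hv 0 1) - F (pr p),
    fun p => F (pr p), fun p => G (pr p + hv 1 0) - G (pr p),
    fun p => G (pr p + hv 0 1) - G (pr p), fun p => G (pr p),
    c1 _ hF, c1 _ hF, c3 hF, c1 _ hG, c1 _ hG, c3 hG,
    dep_of_pr _ (c1 _ hF) ?_, dep_of_pr _ (c1 _ hF) ?_, dep_of_pr _ (c3 hF) ?_,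
    dep_of_pr _ (c1 _ hG) ?_, dep_of_pr _ (c1 _ hG) ?_, dep_of_pr _ (c3 hG) ?_, ?_, ?_⟩
  iterate 6
    · intro p q h
      simp only [h]
  · intro p
    have := (key (pr p) (p 5) (p 9)).1
    rw [← eq_pr p] at this
    linarith
  · intro p
    have := (key (pr p) (p 5) (p 9)).2
    rw [← eq_pr p] at this
    linarith
end

section
/- Let λ₁, λ₂ ∈ ℝ with λ₁² + λ₂² ≠ 0, and k₁, k₂ ∈ ℝ. Set ξ₁(x,t) := λ₁x + (λ₁³ − 3λ₁λ₂²)t + k₁ and ξ₂(x,t) := −λ₂x + (λ₂³ − 3λ₂λ₁²)t + k₂. On the open set U := {(x,t) ∈ ℝ² : λ₁ + e^{ξ₂(x,t)}·sin ξ₁(x,t) ≠ 0}, the functions u′ = −λ₁(λ₁² + λ₂²)/(λ₁ + e^{ξ₂}·sin ξ₁) and v′ = −(e^{ξ₂}/(λ₁² + λ₂²))·(λ₁e^{ξ₂} + (λ₁² − λ₂²)·sin ξ₁ + 2λ₁λ₂·cos ξ₁)/(λ₁ + e^{ξ₂}·sin ξ₁) satisfy the coupled KdV system on U: u′_t = −u′_xxx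 + 6u′v′u′_x and v′_t = −v′_xxx + 6u′v′v′_x. -/
/-- Partial derivative with respect to the first (space) variable. -/
noncomputable def px (f : ℝ × ℝ → ℝ) : ℝ × ℝ → ℝ := fun p => fderiv ℝ f p (1, 0)

/-- Partial derivative with respect to the second (time) variable. -/
noncomputable def pt (f : ℝ × ℝ → ℝ) : ℝ × ℝ → ℝ := fun p => fderiv ℝ f p (0, 1)

/-- Phase `ξ₁`. -/
noncomputable def xi1 (lam1 lam2 k1 : ℝ) (q : ℝ × ℝ) : ℝ :=
  lam1 * q.1 + (lam1 ^ 3 - 3 * lam1 * lam2 ^ 2) * q.2 + k1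

/-- Phase `ξ₂`. -/
noncomputable def xi2 (lam1 lam2 k2 : ℝ) (q : ℝ × ℝ) : ℝ :=
  -(lam2 * q.1) + (lam2 ^ 3 - 3 * lam2 * lam1 ^ 2) * q.2 + k2

/-- The new solution `u'` obtained from `u ≡ 0`, `v ≡ 1` by the Bäcklund
transformation. -/
noncomputable def uNew (lam1 lam2 k1 k2 : ℝ) (q : ℝ × ℝ) : ℝ :=
  -(lam1 * (lam1 ^ 2 + lam2 ^ 2))
    / (lam1 + Real.exp (xi2 lam1 lam2 k2 q) * Real.sin (xi1 lam1 lam2 k1 q))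

/-- The new solution `v'` obtained from `u ≡ 0`, `v ≡ 1` by the Bäcklund
transformation. -/
noncomputable def vNew (lam1 lam2 k1 k2 : ℝ) (q : ℝ × ℝ) : ℝ :=
  -(Real.exp (xi2 lam1 lam2 k2 q) / (lam1 ^ 2 + lam2 ^ 2))
    * (lam1 * Real.exp (xi2 lam1 lam2 k2 q)
        + (lam1 ^ 2 - lam2 ^ 2) * Real.sin (xi1 lam1 lam2 k1 q)
        + 2 * lam1 * lam2 * Real.cos (xi1 lam1 lam2 k1 q))
    / (lam1 + Real.exp (xi2 lam1 lam2 k2 q) * Real.sin (xi1 lam1 lam2 k1 q))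

open Filter Topology

/-- Linear combinations of `e^{2ξ₂}`, `e^{ξ₂} sin ξ₁`, `e^{ξ₂} cos ξ₁` and `1`. -/
noncomputable def Lf (a b k1 k2 r s q c : ℝ) (z : ℝ × ℝ) : ℝ :=
  r * (Real.exp (xi2 a b k2 z) * Real.exp (xi2 a b k2 z))
    + s * (Real.exp (xi2 a b k2 z) * Real.sin (xi1 a b k1 z))
    + q * (Real.exp (xi2 a b k2 z) * Real.cos (xi1 a b k1 z)) + c

/-- `f` is differentiable at `z` with the given partial derivatives. -/
def HasPD (f : ℝ × ℝ → ℝ) (fx ft : ℝ) (z : ℝ × ℝ) : Prop :=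
  ∃ A : ℝ × ℝ →L[ℝ] ℝ, HasFDerivAt f A z ∧ A (1, 0) = fx ∧ A (0, 1) = ft

theorem HasPD.px_eq {f : ℝ × ℝ → ℝ} {fx ft : ℝ} {z : ℝ × ℝ} (h : HasPD f fx ft z) :
    px f z = fx := by
  obtain ⟨A, hA, h1, h2⟩ := h
  simp only [px, hA.fderiv, h1]

theorem HasPD.pt_eq {f : ℝ × ℝ → ℝ} {fx ft : ℝ} {z : ℝ × ℝ} (h : HasPD f fx ft z) :
    pt f z = ft := by
  obtain ⟨A, hA, h1, h2⟩ := h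
  simp only [pt, hA.fderiv, h2]

theorem hasPD_xi1 (a b k1 : ℝ) (z : ℝ × ℝ) :
    HasPD (xi1 a b k1) a (a ^ 3 - 3 * a * b ^ 2) z := by
  refine ⟨_, (((hasFDerivAt_fst (𝕜 := ℝ) (p := z)).const_mul a).add
    ((hasFDerivAt_snd (𝕜 := ℝ) (p := z)).const_mul (a ^ 3 - 3 * a * b ^ 2))).add_const k1, ?_, ?_⟩ <;> simp

theorem hasPD_xi2 (a b k2 : ℝ) (z : ℝ × ℝ) :
    HasPD (xi2 a b k2) (-b) (b ^ 3 - 3 * b * a ^ 2) z := by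
  refine ⟨_, (((hasFDerivAt_fst (𝕜 := ℝ) (p := z)).const_mul b).neg.add
    ((hasFDerivAt_snd (𝕜 := ℝ) (p := z)).const_mul (b ^ 3 - 3 * b * a ^ 2))).add_const k2, ?_, ?_⟩ <;> simp

theorem hasPD_Lf (a b k1 k2 r s q c : ℝ) (z : ℝ × ℝ) :
    HasPD (Lf a b k1 k2 r s q c)
      (Lf a b k1 k2 (-2 * b * r) (-b * s - a * q) (a * s - b * q) 0 z)
      (Lf a b k1 k2 (2 * (b ^ 3 - 3 * b * a ^ 2) * r)
        ((b ^ 3 - 3 * b * a ^ 2) * s - (a ^ 3 - 3 * a * b ^ 2) * q)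
        ((a ^ 3 - 3 * a * b ^ 2) * s + (b ^ 3 - 3 * b * a ^ 2) * q) 0 z) z := by
  obtain ⟨A, hA, hA1, hA2⟩ := hasPD_xi1 a b k1 z
  obtain ⟨B, hB, hB1, hB2⟩ := hasPD_xi2 a b k2 z
  refine ⟨_, ((((hB.exp.mul hB.exp).const_mul r).add ((hB.exp.mul hA.sin).const_mul s)).add
    ((hB.exp.mul hA.cos).const_mul q)).add_const c, ?_, ?_⟩
  · simp [hA1, hB1, Lf]; ring
  · simp [hA2, hB2, Lf]; ring

theorem HasPD.mul {f g : ℝ × ℝ → ℝ} {fx ft gx gt : ℝ} {z : ℝ × ℝ}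
    (hf : HasPD f fx ft z) (hg : HasPD g gx gt z) :
    HasPD (fun w => f w * g w) (fx * g z + f z * gx) (ft * g z + f z * gt) z := by
  obtain ⟨A, hA, hA1, hA2⟩ := hf
  obtain ⟨B, hB, hB1, hB2⟩ := hg
  refine ⟨_, hA.mul hB, ?_, ?_⟩
  · simp [hA1, hB1]; ring
  · simp [hA2, hB2]; ring

theorem HasPD.add {f g : ℝ × ℝ → ℝ} {fx ft gx gt : ℝ} {z : ℝ × ℝ}
    (hf : HasPD f fx ft z) (hg : HasPD g gx gt z) :
    HasPD (fun w => f w + g w) (fx + gx) (ft + gt) z := by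
  obtain ⟨A, hA, hA1, hA2⟩ := hf
  obtain ⟨B, hB, hB1, hB2⟩ := hg
  exact ⟨_, hA.add hB, by simp [hA1, hB1], by simp [hA2, hB2]⟩

theorem HasPD.const_mul {f : ℝ × ℝ → ℝ} {fx ft : ℝ} {z : ℝ × ℝ} (k : ℝ)
    (hf : HasPD f fx ft z) :
    HasPD (fun w => k * f w) (k * fx) (k * ft) z := by
  obtain ⟨A, hA, hA1, hA2⟩ := hf
  exact ⟨_, hA.const_mul k, by simp [hA1], by simp [hA2]⟩

theorem HasPD.inv {f : ℝ × ℝ → ℝ} {fx ft : ℝ} {z : ℝ × ℝ}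
    (hf : HasPD f fx ft z) (h0 : f z ≠ 0) :
    HasPD (fun w => (f w)⁻¹) (-fx * (f z)⁻¹ ^ 2) (-ft * (f z)⁻¹ ^ 2) z := by
  obtain ⟨A, hA, hA1, hA2⟩ := hf
  refine ⟨_, (hasDerivAt_inv h0).comp_hasFDerivAt z hA, ?_, ?_⟩
  · simp [hA1]; ring
  · simp [hA2]; ring

/-- `px` of a function known near `z`. -/
theorem px_congr {f g : ℝ × ℝ → ℝ} {z : ℝ × ℝ} (h : f =ᶠ[𝓝 z] g) : px f z = px g z := by
  simp only [px, h.fderiv_eq]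

/-- Partial derivatives of a quotient. -/
theorem quot_derivs (N N1 N2 N3 Nt D D1 D2 D3 Dt : ℝ × ℝ → ℝ)
    (hN : ∀ z, HasPD N (N1 z) (Nt z) z) (hN1 : ∀ z, ∃ y, HasPD N1 (N2 z) y z)
    (hN2 : ∀ z, ∃ y, HasPD N2 (N3 z) y z)
    (hD : ∀ z, HasPD D (D1 z) (Dt z) z) (hD1 : ∀ z, ∃ y, HasPD D1 (D2 z) y z)
    (hD2 : ∀ z, ∃ y, HasPD D2 (D3 z) y z) (p : ℝ × ℝ) (hp : D p ≠ 0) :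
    pt (fun z => N z * (D z)⁻¹) p = Nt p * (D p)⁻¹ - N p * Dt p * (D p)⁻¹ ^ 2 ∧
    px (fun z => N z * (D z)⁻¹) p = N1 p * (D p)⁻¹ - N p * D1 p * (D p)⁻¹ ^ 2 ∧
    px (px (px (fun z => N z * (D z)⁻¹))) p =
      N3 p * (D p)⁻¹ - 3 * N2 p * D1 p * (D p)⁻¹ ^ 2
        + 3 * N1 p * (2 * D1 p ^ 2 * (D p)⁻¹ ^ 3 - D2 p * (D p)⁻¹ ^ 2)
        + N p * (-D3 p * (D p)⁻¹ ^ 2 + 6 * D1 p * D2 p * (D p)⁻¹ ^ 3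
          - 6 * D1 p ^ 3 * (D p)⁻¹ ^ 4) := by
  have hcont : Continuous D := continuous_iff_continuousAt.2 fun z => by
    obtain ⟨A, hA, _⟩ := hD z
    exact hA.continuousAt
  have hopen : IsOpen {z | D z ≠ 0} := isOpen_ne_fun hcont continuous_const
  have e0 : ∀ z, D z ≠ 0 → HasPD (fun z => N z * (D z)⁻¹) _ _ z := fun z hz =>
    (hN z).mul ((hD z).inv hz)
  have e1 : ∀ z, D z ≠ 0 → px (fun z => N z * (D z)⁻¹) z =
      N1 z * (D z)⁻¹ + (-1) * (N z * (D1 z * ((D z)⁻¹ * (D z)⁻¹))) := fun z hz => by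
    rw [(e0 z hz).px_eq]; ring
  have e2 : ∀ z, D z ≠ 0 → px (px (fun z => N z * (D z)⁻¹)) z =
      N2 z * (D z)⁻¹ + (-2) * (N1 z * (D1 z * ((D z)⁻¹ * (D z)⁻¹)))
       + N z * ((-1) * (D2 z * ((D z)⁻¹ * (D z)⁻¹))
        + 2 * (D1 z * (D1 z * ((D z)⁻¹ * ((D z)⁻¹ * (D z)⁻¹))))) := fun z hz => by
    rw [px_congr (eventually_of_mem (hopen.mem_nhds hz) e1)]
    obtain ⟨y, hy⟩ := hN1 z
    obtain ⟨w, hw⟩ := hD1 z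
    have hI := (hD z).inv hz
    rw [((hy.mul hI).add (((hN z).mul (hw.mul (hI.mul hI))).const_mul (-1))).px_eq]
    ring
  refine ⟨?_, ?_, ?_⟩
  · rw [(e0 p hp).pt_eq]; ring
  · rw [(e0 p hp).px_eq]; ring
  · rw [px_congr (eventually_of_mem (hopen.mem_nhds hp) e2)]
    obtain ⟨y, hy⟩ := hN1 p
    obtain ⟨w, hw⟩ := hD1 p
    obtain ⟨y', hy'⟩ := hN2 p
    obtain ⟨w', hw'⟩ := hD2 p
    have hI := (hD p).inv hp
    rw [(((hy'.mul hI).add ((hy.mul (hw.mul (hI.mul hI))).const_mul (-2))).add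
      ((hN p).mul (((hw'.mul (hI.mul hI)).const_mul (-1)).add
        ((hw.mul (hw.mul (hI.mul (hI.mul hI)))).const_mul 2)))).px_eq]
    ring

/-- The four-parameter family obtained from the solution `u ≡ 0`, `v ≡ 1` by
the Bäcklund transformation solves the coupled KdV system on the open set where
`λ₁ + e^{ξ₂} sin ξ₁ ≠ 0`. -/
theorem backlund_from_zero_one_solution (lam1 lam2 k1 k2 : ℝ)
    (h : lam1 ^ 2 + lam2 ^ 2 ≠ 0) :
    ∀ p ∈ {q : ℝ × ℝ |
        lam1 + Real.exp (xi2 lam1 lam2 k2 q) * Real.sin (xi1 lam1 lam2 k1 q) ≠ 0},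
      pt (uNew lam1 lam2 k1 k2) p
        = -(px (px (px (uNew lam1 lam2 k1 k2))) p)
          + 6 * uNew lam1 lam2 k1 k2 p * vNew lam1 lam2 k1 k2 p
            * px (uNew lam1 lam2 k1 k2) p ∧
      pt (vNew lam1 lam2 k1 k2) p
        = -(px (px (px (vNew lam1 lam2 k1 k2))) p)
          + 6 * uNew lam1 lam2 k1 k2 p * vNew lam1 lam2 k1 k2 p
            * px (vNew lam1 lam2 k1 k2) p := by
  intro p hp
  have hp : lam1 + Real.exp (xi2 lam1 lam2 k2 p) * Real.sin (xi1 lam1 lam2 k1 p) ≠ 0 := hp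
  have hu : uNew lam1 lam2 k1 k2 = fun z =>
      Lf lam1 lam2 k1 k2 0 0 0 (-(lam1 * (lam1 ^ 2 + lam2 ^ 2))) z
        * (Lf lam1 lam2 k1 k2 0 1 0 lam1 z)⁻¹ := by
    funext z
    simp only [uNew, Lf, div_eq_mul_inv]
    ring_nf
  have hv : vNew lam1 lam2 k1 k2 = fun z =>
      Lf lam1 lam2 k1 k2 (-(lam1 / (lam1 ^ 2 + lam2 ^ 2)))
          (-((lam1 ^ 2 - lam2 ^ 2) / (lam1 ^ 2 + lam2 ^ 2)))
          (-(2 * lam1 * lam2 / (lam1 ^ 2 + lam2 ^ 2))) 0 z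
        * (Lf lam1 lam2 k1 k2 0 1 0 lam1 z)⁻¹ := by
    funext z
    have : Lf lam1 lam2 k1 k2 0 1 0 lam1 z = lam1 + Real.exp (xi2 lam1 lam2 k2 z) * Real.sin (xi1 lam1 lam2 k1 z) := by
      simp only [Lf]; ring
    rw [this]
    simp only [vNew, Lf, div_eq_mul_inv]
    ring
  have hD0 : Lf lam1 lam2 k1 k2 0 1 0 lam1 p ≠ 0 := by
    convert hp using 1
    simp only [Lf]; ring
  have key : ∀ r s q c : ℝ, _ := fun r s q c => quot_derivs
    (Lf lam1 lam2 k1 k2 r s q c) _ _ _ _ (Lf lam1 lam2 k1 k2 0 1 0 lam1) _ _ _ _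
    (fun z => hasPD_Lf lam1 lam2 k1 k2 r s q c z)
    (fun z => ⟨_, hasPD_Lf lam1 lam2 k1 k2 _ _ _ _ z⟩)
    (fun z => ⟨_, hasPD_Lf lam1 lam2 k1 k2 _ _ _ _ z⟩)
    (fun z => hasPD_Lf lam1 lam2 k1 k2 _ _ _ _ z)
    (fun z => ⟨_, hasPD_Lf lam1 lam2 k1 k2 _ _ _ _ z⟩)
    (fun z => ⟨_, hasPD_Lf lam1 lam2 k1 k2 _ _ _ _ z⟩) p hD0
  have hR : Real.exp (xi2 lam1 lam2 k2 p) * Real.exp (xi2 lam1 lam2 k2 p)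
      = (Real.exp (xi2 lam1 lam2 k2 p) * Real.sin (xi1 lam1 lam2 k1 p)) ^ 2
        + (Real.exp (xi2 lam1 lam2 k2 p) * Real.cos (xi1 lam1 lam2 k1 p)) ^ 2 := by
    linear_combination (-(Real.exp (xi2 lam1 lam2 k2 p)) ^ 2)
      * Real.sin_sq_add_cos_sq (xi1 lam1 lam2 k1 p)
  rw [hu, hv]
  obtain ⟨a1, a2, a3⟩ := key 0 0 0 (-(lam1 * (lam1 ^ 2 + lam2 ^ 2)))
  obtain ⟨b1, b2, b3⟩ := key (-(lam1 / (lam1 ^ 2 + lam2 ^ 2)))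
    (-((lam1 ^ 2 - lam2 ^ 2) / (lam1 ^ 2 + lam2 ^ 2)))
    (-(2 * lam1 * lam2 / (lam1 ^ 2 + lam2 ^ 2))) 0
  rw [a1, a2, a3, b1, b2, b3]
  clear a1 a2 a3 b1 b2 b3 key hu hv hp
  simp only [Lf, hR] at hD0 ⊢
  generalize Real.exp (xi2 lam1 lam2 k2 p) * Real.sin (xi1 lam1 lam2 k1 p) = P at *
  generalize Real.exp (xi2 lam1 lam2 k2 p) * Real.cos (xi1 lam1 lam2 k1 p) = Q at *
  have hDeq : 0 * (P ^ 2 + Q ^ 2) + 1 * P + 0 * Q + lam1 = P + lam1 := by ring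
  rw [hDeq] at hD0 ⊢
  generalize hDD : P + lam1 = D at *
  obtain rfl : P = D - lam1 := by linarith
  clear hDD hDeq hR
  generalize hMM : lam1 ^ 2 + lam2 ^ 2 = M at *
  constructor
  · field_simp
    subst hMM
    ring
  · field_simp
    subst hMM
    ring
end
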